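/- For every prime p other than 5, t(p) = 2 if and only if the denominator of the Bernoulli number B_{4p} equals 30. -/

import Mathlib

/-- A Toda prime of `n` is an odd prime `p` such that `p - 1` divides `4n`
and `gcd (p, 4n/(p-1)) = 1`. -/
def IsTodaPrime (n p : ℕ) : Prop :=
  p.Prime ∧ Odd p ∧ (p - 1) ∣ 4 * n ∧ Nat.gcd p (4 * n / (p - 1)) = 1

/-- The set of Toda primes of `n`. -/
def TodaSet (n : ℕ) : Set ℕ := {p | IsTodaPrime n p}

/-- The denominator of a sum of two rationals with coprime denominators is the product of the
denominators. -/
theorem Rat.add_den_of_coprime {a b : ℚ} (h : a.den.Coprime b.den) :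
    (a + b).den = a.den * b.den := by
  refine Nat.dvd_antisymm (Rat.add_den_dvd a b) (h.mul_dvd_of_dvd_of_dvd ?_ ?_)
  · have h1 := Rat.sub_den_dvd (a + b) b
    rw [add_sub_cancel_right] at h1
    exact h.dvd_of_dvd_mul_right h1
  · have h1 := Rat.sub_den_dvd (a + b) a
    rw [add_sub_cancel_left] at h1
    exact h.symm.dvd_of_dvd_mul_right h1

theorem Rat.den_sum_one_div_primes (s : Finset ℕ) (hs : ∀ q ∈ s, q.Prime) :
    (∑ q ∈ s, (1 : ℚ) / q).den = ∏ q ∈ s, q := by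
  induction s using Finset.induction_on with
  | empty => simp
  | insert a s ha ih =>
    have hprime : ∀ q ∈ s, q.Prime := fun q hq => hs q (Finset.mem_insert_of_mem hq)
    have hap : a.Prime := hs a (Finset.mem_insert_self a s)
    have hden : ((1 : ℚ) / a).den = a := by simp [hap.ne_zero]
    have hcop : ((1 : ℚ) / a).den.Coprime (∑ q ∈ s, (1 : ℚ) / q).den := by
      rw [hden, ih hprime]
      refine Nat.Coprime.prod_right fun q hq => (Nat.coprime_primes hap (hprime q hq)).2 ?_
      rintro rfl
      exact ha hq
    rw [Finset.sum_insert ha, Finset.prod_insert ha, Rat.add_den_of_coprime hcop, hden,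
      ih hprime]

/-- The denominator form of the von Staudt-Clausen theorem. -/
theorem bernoulli_two_mul_den (k : ℕ) :
    (bernoulli (2 * k)).den =
      ∏ q ∈ Finset.range (2 * k + 2) with q.Prime ∧ (q - 1) ∣ 2 * k, q := by
  obtain ⟨n, hn⟩ := Bernoulli.vonStaudt_clausen k
  rw [eq_sub_of_add_eq hn.symm, Rat.intCast_sub_den, Rat.den_sum_one_div_primes]
  intro q hq
  exact (Finset.mem_filter.1 hq).2.1

theorem bernoulli_four_mul_den_eq_thirty_iff {n : ℕ} (hn : n ≠ 0) :
    (bernoulli (4 * n)).den = 30 ↔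
      ∀ q : ℕ, q.Prime → (q - 1) ∣ 4 * n → q ∈ ({2, 3, 5} : Finset ℕ) := by
  have hmem : ∀ q : ℕ, q ∈ (Finset.range (4 * n + 2)).filter
      (fun q => q.Prime ∧ (q - 1) ∣ 4 * n) ↔ q.Prime ∧ (q - 1) ∣ 4 * n := by
    intro q
    rw [Finset.mem_filter, Finset.mem_range, and_iff_right_iff_imp]
    rintro ⟨-, hd⟩
    have := Nat.le_of_dvd (by lia) hd
    lia
  have hden := bernoulli_two_mul_den (2 * n)
  rw [show 2 * (2 * n) = 4 * n by ring] at hden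
  rw [hden]
  constructor
  · intro h q hq hd
    have hdvd : q ∣ 30 := h ▸ Finset.dvd_prod_of_mem (fun q => q) ((hmem q).2 ⟨hq, hd⟩)
    have hle := Nat.le_of_dvd (by norm_num) hdvd
    interval_cases q <;> revert hq hdvd <;> decide
  · intro h
    have hset : (Finset.range (4 * n + 2)).filter
        (fun q => q.Prime ∧ (q - 1) ∣ 4 * n) = {2, 3, 5} := by
      ext q
      rw [hmem]
      refine ⟨fun hq => h q hq.1 hq.2, fun hq => ?_⟩
      simp only [Finset.mem_insert, Finset.mem_singleton] at hq
      rcases hq with rfl | rfl | rfl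
      · exact ⟨by norm_num, by simp⟩
      · exact ⟨by norm_num, by lia⟩
      · exact ⟨by norm_num, by simp⟩
    rw [hset]
    decide

/-- For a prime `p` other than `3` and `5`, the coprimality condition on Toda primes of `p` is
automatic. -/
theorem isTodaPrime_prime_iff {p q : ℕ} (hp : p.Prime) (h3 : p ≠ 3) (h5 : p ≠ 5) :
    IsTodaPrime p q ↔ q.Prime ∧ Odd q ∧ (q - 1) ∣ 4 * p := by
  refine ⟨fun h => ⟨h.1, h.2.1, h.2.2.1⟩, fun ⟨hq, hodd, hd⟩ => ⟨hq, hodd, hd, ?_⟩⟩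
  refine (Nat.Prime.coprime_iff_not_dvd hq).2 fun hdvd => ?_
  have hq4p : q ∣ 4 * p := hdvd.trans (Nat.div_dvd_of_dvd hd)
  have hq4 : q.Coprime 4 := (Nat.coprime_two_right.2 hodd).pow_right 2
  obtain rfl := (Nat.prime_dvd_prime_iff_eq hq hp).1 (hq4.dvd_of_dvd_mul_left hq4p)
  have hcop : (q - 1).Coprime q := (Nat.coprime_self_sub_left hq.one_le).2 (by simp)
  have hle := Nat.le_of_dvd (by norm_num) (hcop.dvd_of_dvd_mul_right hd)
  have hle5 : q ≤ 5 := by lia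
  interval_cases q <;> contradiction

theorem finite_todaSet {n : ℕ} (hn : n ≠ 0) : (TodaSet n).Finite := by
  refine (Set.finite_Iic (4 * n + 1)).subset fun q hq => ?_
  have := Nat.le_of_dvd (by lia) hq.2.2.1
  simp only [Set.mem_Iic]
  lia

theorem toda_two_iff_bernoulli_den (p : ℕ) (hp : p.Prime) (h5 : p ≠ 5) :
    (TodaSet p).ncard = 2 ↔ (bernoulli (4 * p)).den = 30 := by
  rw [bernoulli_four_mul_den_eq_thirty_iff hp.ne_zero]
  have hfin := finite_todaSet hp.ne_zero
  obtain rfl | h3 := eq_or_ne p 3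
  · have hsub : (({5, 7, 13} : Finset ℕ) : Set ℕ) ⊆ TodaSet 3 := by
      intro q hq
      simp only [Finset.coe_insert, Finset.coe_singleton, Set.mem_insert_iff,
        Set.mem_singleton_iff] at hq
      rcases hq with rfl | rfl | rfl <;> exact ⟨by norm_num, by decide, by decide, by decide⟩
    have hcard := Set.ncard_le_ncard hsub hfin
    rw [Set.ncard_coe_finset, show ({5, 7, 13} : Finset ℕ).card = 3 from rfl] at hcard
    exact iff_of_false (by lia) fun h => absurd (h 7 (by norm_num) (by decide)) (by decide)
  · have htoda (q : ℕ) : q ∈ TodaSet p ↔ q.Prime ∧ Odd q ∧ (q - 1) ∣ 4 * p :=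
      isTodaPrime_prime_iff hp h3 h5
    have hsub : ({3, 5} : Set ℕ) ⊆ TodaSet p := by
      rintro q (rfl | rfl) <;> rw [htoda]
      · exact ⟨by norm_num, by decide, by lia⟩
      · exact ⟨by norm_num, by decide, by simp⟩
    have hpair : ({3, 5} : Set ℕ).ncard = 2 := Set.ncard_pair (by norm_num)
    constructor
    · intro h q hq hd
      have heq := Set.eq_of_subset_of_ncard_le hsub (by rw [h, hpair]) hfin
      obtain rfl | hodd := hq.eq_two_or_odd'
      · simp
      · have hmem : q ∈ ({3, 5} : Set ℕ) := heq ▸ (htoda q).2 ⟨hq, hodd, hd⟩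
        exact Finset.mem_insert_of_mem (by simpa using hmem)
    · intro h
      rw [← hpair]
      congr 1
      refine subset_antisymm (fun q hq => ?_) hsub
      obtain ⟨hprime, hodd, hd⟩ := (htoda q).1 hq
      have hmem := h q hprime hd
      simp only [Finset.mem_insert, Finset.mem_singleton] at hmem
      rcases hmem with rfl | hmem
      · exact absurd hodd (by decide)
      · exact hmem
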